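/- For every signed graph (G,σ) and every positive integer k, the chromatic number of the exact-distance -k graph of (G,σ) is at most wcol_{2k}(G), the weak 2k-colouring number of G. -/

import Mathlib

open SimpleGraph

/-- The number of negative edges of a walk, where `σ e = true` means edge `e` is negative. -/
def negCount {V : Type} {G : SimpleGraph V} (σ : Sym2 V → Bool) {x y : V}
    (p : G.Walk x y) : ℕ :=
  (p.edges.filter (fun e => σ e)).length

/-- A walk is negative if it contains an odd number of negative edges. -/
def IsNegWalk {V : Type} {G : SimpleGraph V} (σ : Sym2 V → Bool) {x y : V}
    (p : G.Walk x y) : Prop :=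
  Odd (negCount σ p)

/-- The exact-distance `-k` graph of the signed graph `(G, σ)`:
`xy` is an edge iff `d_G(x,y) = k` and every `xy`-path of length `k` is negative. -/
def exactDistNeg {V : Type} (G : SimpleGraph V) (σ : Sym2 V → Bool) (k : ℕ) :
    SimpleGraph V :=
  SimpleGraph.fromRel (fun x y =>
    G.dist x y = k ∧ ∀ p : G.Walk x y, p.IsPath → p.length = k → IsNegWalk σ p)

/-- The strong exact-distance `-k` graph of the signed graph `(G, σ)`:
`xy` is an edge iff `d_G(x,y) = k` and some `xy`-path of length `k` is negative. -/
def strongExactDistNeg {V : Type} (G : SimpleGraph V) (σ : Sym2 V → Bool) (k : ℕ) :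
    SimpleGraph V :=
  SimpleGraph.fromRel (fun x y =>
    G.dist x y = k ∧ ∃ p : G.Walk x y, p.IsPath ∧ p.length = k ∧ IsNegWalk σ p)

/-- `WReach G L k y` : the set of vertices weakly `k`-reachable from `y` w.r.t. ordering `L`. -/
def WReach {V : Type} (G : SimpleGraph V) (L : LinearOrder V) (k : ℕ) (y : V) : Set V :=
  {x | ∃ p : G.Walk x y, p.IsPath ∧ p.length ≤ k ∧ ∀ z ∈ p.support, L.le x z}

/-- The weak `k`-colouring number of `G`. -/
noncomputable def wcol {V : Type} (G : SimpleGraph V) (k : ℕ) : ℕ :=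
  ⨅ L : LinearOrder V, ⨆ y : V, (WReach G L k y).ncard

/-- `DReach G L k y` : the set of vertices `x` such that there is an `xy`-path
`z_0, …, z_s` (`x = z_0`, `y = z_s`) of length `s ≤ k` on which `x` is the `L`-minimum
and `y ≤_L z_i` for all `⌊k/2⌋ + 1 ≤ i ≤ s`. -/
def DReach {V : Type} (G : SimpleGraph V) (L : LinearOrder V) (k : ℕ) (y : V) : Set V :=
  {x | ∃ p : G.Walk x y, p.IsPath ∧ p.length ≤ k ∧ (∀ z ∈ p.support, L.le x z) ∧
        ∀ i, k / 2 + 1 ≤ i → i ≤ p.length → L.le y (p.support.getD i y)}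

/-- The distance-`k`-colouring number of `G`. -/
noncomputable def dcol {V : Type} (G : SimpleGraph V) (k : ℕ) : ℕ :=
  ⨅ L : LinearOrder V, ⨆ y : V, (DReach G L k y).ncard

/-- `SReach G L k y` : the set of vertices strongly `k`-reachable from `y` w.r.t. `L`. -/
def SReach {V : Type} (G : SimpleGraph V) (L : LinearOrder V) (k : ℕ) (y : V) : Set V :=
  {x | ∃ p : G.Walk x y, p.IsPath ∧ p.length ≤ k ∧ (∀ z ∈ p.support, L.le x z) ∧
        ∀ z ∈ p.support, z ≠ x → L.le y z}

/-- The strong `k`-colouring number of `G`. -/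
noncomputable def scol {V : Type} (G : SimpleGraph V) (k : ℕ) : ℕ :=
  ⨅ L : LinearOrder V, ⨆ y : V, (SReach G L k y).ncard

/-- `H` is a minor of `G` (branch-set definition). -/
def IsMinor {W V : Type} (H : SimpleGraph W) (G : SimpleGraph V) : Prop :=
  ∃ B : W → Set V,
    (∀ w, (B w).Nonempty) ∧
    (∀ w, (G.induce (B w)).Connected) ∧
    (Pairwise (Function.onFun Disjoint B)) ∧
    ∀ w w', H.Adj w w' → ∃ u ∈ B w, ∃ v ∈ B w', G.Adj u v

/-- `G` is planar iff it has no `K₅` and no `K₃,₃` minor (Wagner's theorem). -/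
def IsPlanar {V : Type} (G : SimpleGraph V) : Prop :=
  ¬ IsMinor (completeGraph (Fin 5)) G ∧
  ¬ IsMinor (completeBipartiteGraph (Fin 3) (Fin 3)) G

/-- `G` is outerplanar iff it has no `K₄` and no `K₂,₃` minor. -/
def IsOuterplanar {V : Type} (G : SimpleGraph V) : Prop :=
  ¬ IsMinor (completeGraph (Fin 4)) G ∧
  ¬ IsMinor (completeBipartiteGraph (Fin 2) (Fin 3)) G

/-- `G` has treewidth at most `t` (tree-decomposition definition). -/
def HasTreewidthLE {V : Type} (G : SimpleGraph V) (t : ℕ) : Prop :=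
  ∃ (ι : Type) (T : SimpleGraph ι) (B : ι → Finset V),
    T.Connected ∧ T.IsAcyclic ∧
    (∀ v, ∃ i, v ∈ B i) ∧
    (∀ u v, G.Adj u v → ∃ i, u ∈ B i ∧ v ∈ B i) ∧
    (∀ v, (T.induce {i | v ∈ B i}).Connected) ∧
    (∀ i, (B i).card ≤ t + 1)

theorem negCount_append {V : Type} {G : SimpleGraph V} (σ : Sym2 V → Bool) {x y z : V}
    (p : G.Walk x y) (q : G.Walk y z) :
    negCount σ (p.append q) = negCount σ p + negCount σ q := by
  simp [negCount, Walk.edges_append]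

theorem negCount_reverse {V : Type} {G : SimpleGraph V} (σ : Sym2 V → Bool) {x y : V}
    (p : G.Walk x y) : negCount σ p.reverse = negCount σ p := by
  simp [negCount, Walk.edges_reverse, List.filter_reverse]

/-- A walk is `k`-short if its length is less than `k / 2`, or is exactly `k / 2` and the walk
is positive. -/
def IsShortWalk {V : Type} {G : SimpleGraph V} (σ : Sym2 V → Bool) (k : ℕ) {x y : V}
    (p : G.Walk x y) : Prop :=
  2 * p.length < k ∨ 2 * p.length = k ∧ Even (negCount σ p)

/-- The set of vertices reached from `u` by a `k`-short walk. -/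
def shortBall {V : Type} (G : SimpleGraph V) (σ : Sym2 V → Bool) (k : ℕ) (u : V) : Set V :=
  {w | ∃ p : G.Walk u w, IsShortWalk σ k p}

theorem IsShortWalk.two_mul_length_le {V : Type} {G : SimpleGraph V} {σ : Sym2 V → Bool} {k : ℕ}
    {x y : V} {p : G.Walk x y} (hp : IsShortWalk σ k p) : 2 * p.length ≤ k := by
  rcases hp with h | h <;> omega

theorem mem_shortBall_self {V : Type} (G : SimpleGraph V) (σ : Sym2 V → Bool) {k : ℕ}
    (hk : 1 ≤ k) (u : V) : u ∈ shortBall G σ k u :=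
  ⟨Walk.nil, Or.inl (by rw [Walk.length_nil]; omega)⟩

theorem IsShortWalk.support_subset {V : Type} {G : SimpleGraph V} {σ : Sym2 V → Bool} {k : ℕ}
    {u w : V} {p : G.Walk u w} (hp : IsShortWalk σ k p) {z : V} (hz : z ∈ p.support) :
    z ∈ shortBall G σ k u := by
  classical
  by_cases hzw : z = w
  · subst hzw
    exact ⟨p, hp⟩
  · refine ⟨p.takeUntil z hz, Or.inl ?_⟩
    have := p.length_takeUntil_lt_length hz hzw
    have := hp.two_mul_length_le
    omega

theorem disjoint_shortBall {V : Type} {G : SimpleGraph V} {σ : Sym2 V → Bool} {k : ℕ} {u v : V}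
    (hd : G.dist u v = k)
    (hneg : ∀ p : G.Walk u v, p.IsPath → p.length = k → IsNegWalk σ p) :
    Disjoint (shortBall G σ k u) (shortBall G σ k v) := by
  rw [Set.disjoint_left]
  rintro w ⟨p, hp⟩ ⟨q, hq⟩
  have hlen : (p.append q.reverse).length = p.length + q.length := by simp
  have hle := dist_le (p.append q.reverse)
  have hp' := hp.two_mul_length_le
  have hq' := hq.two_mul_length_le
  have hk : (p.append q.reverse).length = k := by omega
  have hodd := hneg _ (Walk.isPath_of_length_eq_dist _ (hk.trans hd.symm)) hk
  rw [IsNegWalk, negCount_append, negCount_reverse, ← Nat.not_even_iff_odd] at hodd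
  rcases hp with hp | ⟨-, hp⟩
  · omega
  rcases hq with hq | ⟨-, hq⟩
  · omega
  exact hodd (hp.add hq)

theorem support_subset_shortBall_union {V : Type} {G : SimpleGraph V} {σ : Sym2 V → Bool} {k : ℕ}
    {u v : V} {g : G.Walk u v} (hk : g.length = k) (hneg : IsNegWalk σ g) {z : V}
    (hz : z ∈ g.support) : z ∈ shortBall G σ k u ∪ shortBall G σ k v := by
  classical
  have hspec := g.take_spec hz
  set p := g.takeUntil z hz
  set q := g.dropUntil z hz
  have hlen : p.length + q.length = k := by rw [← Walk.length_append, hspec, hk]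
  rw [IsNegWalk, ← hspec, negCount_append, Nat.odd_add] at hneg
  by_cases hpk : IsShortWalk σ k p
  · exact Or.inl ⟨p, hpk⟩
  · refine Or.inr ⟨q.reverse, ?_⟩
    simp only [IsShortWalk, Walk.length_reverse, negCount_reverse, not_or, not_and,
      Nat.not_even_iff_odd] at hpk ⊢
    by_cases h : 2 * p.length = k
    · exact Or.inr ⟨by omega, hneg.1 (hpk.2 h)⟩
    · left; omega

theorem mem_WReach_of_walk {V : Type} {G : SimpleGraph V} (L : LinearOrder V) {k : ℕ} {x y : V}
    (p : G.Walk x y) (hlen : p.length ≤ k) (hmin : ∀ z ∈ p.support, L.le x z) :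
    x ∈ WReach G L k y := by
  classical
  exact ⟨p.bypass, p.bypass_isPath, p.length_bypass_le_length.trans hlen,
    fun z hz => hmin z (p.support_bypass_subset_support hz)⟩

theorem le_of_mem_WReach {V : Type} {G : SimpleGraph V} {L : LinearOrder V} {k : ℕ} {x y : V}
    (h : x ∈ WReach G L k y) : L.le x y := by
  obtain ⟨p, -, -, hp⟩ := h
  exact hp y p.end_mem_support

theorem self_mem_WReach {V : Type} (G : SimpleGraph V) (L : LinearOrder V) (k : ℕ) (y : V) :
    y ∈ WReach G L k y :=
  mem_WReach_of_walk L Walk.nil (by simp) (by simp)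

theorem minimal_shortBall_mem_WReach {V : Type} {G : SimpleGraph V} {σ : Sym2 V → Bool} {k : ℕ}
    (L : LinearOrder V) {u v a b : V} (hk : 1 ≤ k) (hd : G.dist u v = k)
    (hneg : ∀ p : G.Walk u v, p.IsPath → p.length = k → IsNegWalk σ p)
    (ha : a ∈ shortBall G σ k u) (ha' : ∀ z ∈ shortBall G σ k u, L.le a z)
    (hb : b ∈ shortBall G σ k v) (hb' : ∀ z ∈ shortBall G σ k v, L.le b z) :
    a ∈ WReach G L (2 * k) b ∨ b ∈ WReach G L (2 * k) a := by
  obtain ⟨p, hp⟩ := ha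
  obtain ⟨q, hq⟩ := hb
  have hr : G.Reachable u v := Reachable.of_dist_ne_zero (by omega)
  obtain ⟨g, hg⟩ := hr.exists_walk_length_eq_dist
  have hg_neg := hneg g (Walk.isPath_of_length_eq_dist g hg) (hg.trans hd)
  let r : G.Walk a b := p.reverse.append (g.append q)
  have hlen : r.length ≤ 2 * k := by
    have := hp.two_mul_length_le
    have := hq.two_mul_length_le
    simp only [r, Walk.length_append, Walk.length_reverse]
    omega
  have hsupp : ∀ z ∈ r.support, z ∈ shortBall G σ k u ∪ shortBall G σ k v := by
    intro z hz
    simp only [r, Walk.mem_support_append_iff, Walk.support_reverse, List.mem_reverse] at hz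
    rcases hz with hz | hz | hz
    · exact Or.inl (hp.support_subset hz)
    · exact support_subset_shortBall_union (hg.trans hd) hg_neg hz
    · exact Or.inr (hq.support_subset hz)
  rcases L.le_total a b with hab | hba
  · exact Or.inl (mem_WReach_of_walk L r hlen fun z hz =>
      (hsupp z hz).elim (ha' z) fun h => L.le_trans _ _ _ hab (hb' z h))
  · refine Or.inr (mem_WReach_of_walk L r.reverse (by simpa using hlen) fun z hz => ?_)
    rw [Walk.support_reverse, List.mem_reverse] at hz
    exact (hsupp z hz).elim (fun h => L.le_trans _ _ _ hba (ha' z h)) (hb' z)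

/-- Greedy colouring along a well-founded order. -/
theorem exists_greedy_coloring {V : Type*} [Preorder V] [WellFoundedLT V] (R : V → Finset V)
    (hR : ∀ y, ∀ x ∈ R y, x < y) :
    ∃ c : V → ℕ, ∀ y, c y ≤ (R y).card ∧ ∀ x ∈ R y, c x ≠ c y := by
  classical
  have hfree : ∀ (f : V → ℕ) (y : V), ∃ n ≤ (R y).card, n ∉ (R y).image f := by
    intro f y
    obtain ⟨n, hn, hn'⟩ := Finset.exists_mem_notMem_of_card_lt_card
      (s := (R y).image f) (t := Finset.range ((R y).card + 1))
      (by simpa using Nat.lt_succ_of_le Finset.card_image_le)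
    exact ⟨n, by simpa [Nat.lt_succ_iff] using hn, hn'⟩
  choose pick hpick hpick' using hfree
  let F : ∀ y : V, (∀ x, x < y → ℕ) → ℕ :=
    fun y ih => pick (fun x => if h : x < y then ih x h else 0) y
  let c : V → ℕ := wellFounded_lt.fix F
  have hc : ∀ y, c y = pick (fun x => if x < y then c x else 0) y := by
    intro y
    simpa [F] using wellFounded_lt.fix_eq F y
  refine ⟨c, fun y => ⟨by rw [hc]; exact hpick _ _, fun x hx hxy => ?_⟩⟩
  apply hpick' (fun x => if x < y then c x else 0) y
  rw [← hc, ← hxy]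
  exact Finset.mem_image.2 ⟨x, hx, if_pos (hR y x hx)⟩

theorem exactDistNeg_colorable {V : Type} [Finite V] (G : SimpleGraph V) (σ : Sym2 V → Bool)
    {k : ℕ} (hk : 1 ≤ k) (L : LinearOrder V) :
    (exactDistNeg G σ k).Colorable (⨆ y : V, (WReach G L (2 * k) y).ncard) := by
  classical
  have := Fintype.ofFinite V
  obtain ⟨c, hc⟩ := exists_greedy_coloring
    (fun y => (WReach G L (2 * k) y).toFinset.erase y) (by
      intro y x hx
      rw [Finset.mem_erase, Set.mem_toFinset] at hx
      exact lt_of_le_of_ne (le_of_mem_WReach hx.2) hx.1)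
  have hlt : ∀ y, c y < ⨆ y : V, (WReach G L (2 * k) y).ncard := by
    intro y
    have hmem : y ∈ (WReach G L (2 * k) y).toFinset :=
      Set.mem_toFinset.2 (self_mem_WReach G L _ y)
    have hle := (hc y).1
    have hcard := Finset.card_erase_add_one hmem
    rw [← Set.ncard_eq_toFinset_card'] at hcard
    have := le_ciSup (f := fun y : V => (WReach G L (2 * k) y).ncard)
      (Set.finite_range _).bddAbove y
    omega
  have hne : ∀ a b, a ∈ WReach G L (2 * k) b → a ≠ b → c a ≠ c b := fun a b h hab =>
    (hc b).2 a (Finset.mem_erase.2 ⟨hab, Set.mem_toFinset.2 h⟩)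
  have hmin : ∀ u, ∃ a ∈ shortBall G σ k u, ∀ z ∈ shortBall G σ k u, L.le a z := fun u =>
    Set.exists_min_image _ id (Set.toFinite _) ⟨u, mem_shortBall_self G σ hk u⟩
  choose m hm hm' using hmin
  have hrel : ∀ u v, G.dist u v = k →
      (∀ p : G.Walk u v, p.IsPath → p.length = k → IsNegWalk σ p) → c (m u) ≠ c (m v) := by
    intro u v hd hneg
    have hmne := (disjoint_shortBall hd hneg).ne_of_mem (hm u) (hm v)
    rcases minimal_shortBall_mem_WReach L hk hd hneg (hm u) (hm' u) (hm v) (hm' v) with h | h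
    · exact hne _ _ h hmne
    · exact (hne _ _ h hmne.symm).symm
  refine ⟨Coloring.mk (fun v => ⟨c (m v), hlt _⟩) ?_⟩
  intro u v huv heq
  rw [exactDistNeg, fromRel_adj] at huv
  rw [Fin.mk.injEq] at heq
  rcases huv.2 with ⟨hd, hneg⟩ | ⟨hd, hneg⟩
  · exact hrel u v hd hneg heq
  · exact hrel v u hd hneg heq.symm

theorem exactDistNeg_chromatic_le_wcol
    {V : Type} [Fintype V] (G : SimpleGraph V) (σ : Sym2 V → Bool) (k : ℕ) (hk : 1 ≤ k) :
    (exactDistNeg G σ k).chromaticNumber ≤ (wcol G (2 * k) : ℕ∞) := by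
  classical
  have : Nonempty (LinearOrder V) := ⟨linearOrderOfSTO (WellOrderingRel (α := V))⟩
  obtain ⟨L, hL⟩ := Nat.sInf_mem
    (Set.range_nonempty fun L : LinearOrder V => ⨆ y : V, (WReach G L (2 * k) y).ncard)
  have hcol := (exactDistNeg_colorable G σ hk L).chromaticNumber_le
  dsimp only at hL
  rw [hL] at hcol
  exact hcol
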